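/- arXiv:1612.03678 — 4 statements merged into one kernel-verified Lean document; each statement's English description precedes it below -/
import Mathlib

section
/- Let X, Y, Z be small categories, f : X ⥤ Psh(Y) and g : Y ⥤ Psh(Z) functors. Then there is a natural isomorphism (f ⋙ g*)* ≅ f* ⋙ g* of functors Psh(X) ⥤ Psh(Z). -/
open CategoryTheory CategoryTheory.Limits

universe u
universe w w₂ v

/-- A left Kan extension along the Yoneda embedding of a small category preserves colimits. -/
lemma preservesColimitsOfSize_of_isLeftKanExtension_yoneda {C : Type u}
    [SmallCategory C] {E : Type v} [Category.{u} E] [HasColimitsOfSize.{u, u} E] {F : C ⥤ E}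
    (L : (Cᵒᵖ ⥤ Type u) ⥤ E) (α : F ⟶ yoneda ⋙ L) [L.IsLeftKanExtension α] :
    PreservesColimitsOfSize.{w, w₂} L := by
  let e : yoneda (C := C) ≅ uliftYoneda.{u} := uliftYonedaIsoYoneda.symm
  have : L.IsLeftKanExtension (α ≫ Functor.whiskerRight e.hom L) :=
    ⟨⟨IsInitial.isInitialObj (Functor.leftExtensionEquivalenceOfIso₁ e F).functor _
      (L.isUniversalOfIsLeftKanExtension α)⟩⟩
  exact Presheaf.preservesColimitsOfSize_of_isLeftKanExtension L
    (α ≫ Functor.whiskerRight e.hom L)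

/-- For small categories `X`, `Y`, `Z` and functors `f : X ⥤ Psh(Y)`, `g : Y ⥤ Psh(Z)`,
there is a natural isomorphism `(f ⋙ g*)* ≅ f* ⋙ g*`, where `(-)*` denotes left Kan
extension along the Yoneda embedding. This is the associativity constraint `μ` of the
relative pseudomonad of presheaves. -/
theorem leftKanExtension_comp_iso
    (X Y Z : Type u) [SmallCategory X] [SmallCategory Y] [SmallCategory Z]
    (f : X ⥤ Yᵒᵖ ⥤ Type u) (g : Y ⥤ Zᵒᵖ ⥤ Type u) :
    Nonempty (yoneda.leftKanExtension (f ⋙ yoneda.leftKanExtension g) ≅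
      yoneda.leftKanExtension f ⋙ yoneda.leftKanExtension g) := by
  have := preservesColimitsOfSize_of_isLeftKanExtension_yoneda.{u, u, u, u + 1}
    (yoneda.leftKanExtension g) (yoneda.leftKanExtensionUnit g)
  exact ⟨((yoneda.leftKanExtension g).leftKanExtensionCompIsoOfPreserves f yoneda).symm⟩
end

section
/- Let X, Y, Z, V be small categories and f : X ⥤ Psh(Y), g : Y ⥤ Psh(Z), h : Z ⥤ Psh(V) functors. Then there is a natural isomorphism f ⋙ (g ⋙ h*)* ≅ (f ⋙ g*) ⋙ h* of functors X ⥤ Psh(V). -/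
open CategoryTheory CategoryTheory.Limits

universe u

/-- The Yoneda embedding of a small category agrees with its universe-lifted version. -/
def yonedaIsoULiftYoneda (C : Type u) [SmallCategory C] :
    (yoneda : C ⥤ Cᵒᵖ ⥤ Type u) ≅ uliftYoneda.{u} :=
  (Functor.rightUnitor _).symm ≪≫ Functor.isoWhiskerLeft yoneda
    ((Functor.whiskeringRight Cᵒᵖ _ _).mapIso uliftFunctorTrivial.symm :
      (Functor.whiskeringRight Cᵒᵖ _ _).obj (𝟭 (Type u)) ≅ _)

/-- The left Kan extension along the Yoneda embedding of a presheaf-valued functor on a small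
category preserves colimits. -/
lemma preservesColimits_yoneda_leftKanExtension {C D : Type u} [SmallCategory C] [SmallCategory D]
    (F : C ⥤ Dᵒᵖ ⥤ Type u) :
    PreservesColimitsOfSize.{u, u} (yoneda.leftKanExtension F) := by
  let α := yoneda.leftKanExtensionUnit F ≫
    Functor.whiskerRight (yonedaIsoULiftYoneda C).hom (yoneda.leftKanExtension F)
  have : (yoneda.leftKanExtension F).IsLeftKanExtension α :=
    ⟨⟨IsInitial.isInitialObj
      (Functor.leftExtensionEquivalenceOfIso₁ (yonedaIsoULiftYoneda C) F).functor _
      (Functor.isUniversalOfIsLeftKanExtension _ (yoneda.leftKanExtensionUnit F))⟩⟩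
  exact Presheaf.preservesColimitsOfSize_of_isLeftKanExtension.{u} _ α

/-- For small categories `X`, `Y`, `Z`, `V` and functors `f : X ⥤ Psh(Y)`, `g : Y ⥤ Psh(Z)`,
`h : Z ⥤ Psh(V)`, there is a natural isomorphism `f ⋙ (g ⋙ h*)* ≅ (f ⋙ g*) ⋙ h*`, where
`(-)*` denotes left Kan extension along the Yoneda embedding. This is the associativity
constraint of the bicategory of profunctors. -/
theorem profunctor_composition_assoc_iso
    (X Y Z V : Type u) [SmallCategory X] [SmallCategory Y] [SmallCategory Z] [SmallCategory V]
    (f : X ⥤ Yᵒᵖ ⥤ Type u) (g : Y ⥤ Zᵒᵖ ⥤ Type u) (h : Z ⥤ Vᵒᵖ ⥤ Type u) :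
    Nonempty (f ⋙ yoneda.leftKanExtension (g ⋙ yoneda.leftKanExtension h) ≅
      (f ⋙ yoneda.leftKanExtension g) ⋙ yoneda.leftKanExtension h) := by
  have := preservesColimits_yoneda_leftKanExtension h
  exact ⟨Functor.isoWhiskerLeft f (Functor.leftKanExtensionCompIsoOfPreserves
    (yoneda.leftKanExtension h) g yoneda).symm ≪≫ (Functor.associator _ _ _).symm⟩
end

section
/- Let A and B be small categories, suppose A has finite limits, and let F : A ⥤ Psh(B) be a functor preserving finite limits. Then the left Kan extension F* : Psh(A) ⥤ Psh(B) of F along the Yoneda embedding y_A preserves finite limits. -/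
open CategoryTheory CategoryTheory.Limits

universe u

namespace CategoryTheory.Functor

/-- A colimit-preserving functor on presheaves is the left Kan extension along the Yoneda
embedding of its restriction to representables. -/
noncomputable def isoLeftKanExtensionYoneda {A : Type u} [SmallCategory A]
    {E : Type*} [Category.{u} E] [HasColimitsOfSize.{u, u} E]
    (L : (Aᵒᵖ ⥤ Type u) ⥤ E) [PreservesColimitsOfSize.{u, u} L]
    {G : A ⥤ E} (e : yoneda ⋙ L ≅ G) :
    L ≅ yoneda.leftKanExtension G :=
  leftKanExtensionUniqueOfIso (𝟭 _ ⋙ L)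
    (whiskerRight (rightUnitor yoneda).inv L ≫ (associator _ _ _).hom) e _
    (yoneda.leftKanExtensionUnit G)

/-- If `A` has finite limits and `G : A ⥤ Type u` preserves them, then so does the left Kan
extension of `G` along the Yoneda embedding, since it is the filtered colimit of the evaluation
functors indexed by the opposite of the category of elements of `G`. -/
lemma preservesFiniteLimits_leftKanExtension_yoneda_of_type {A : Type u} [SmallCategory A]
    [HasFiniteLimits A] (G : A ⥤ Type u) [PreservesFiniteLimits G] :
    PreservesFiniteLimits (yoneda.leftKanExtension G) := by
  have := G.isCofiltered_elements
  let L : (Aᵒᵖ ⥤ Type u) ⥤ Type u :=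
    (whiskeringLeft _ _ _).obj (CategoryOfElements.π G).op ⋙ colim
  have : PreservesFiniteLimits L := comp_preservesFiniteLimits _ _
  have : PreservesColimitsOfSize.{u, u} L := ⟨by dsimp [L]; infer_instance⟩
  exact preservesFiniteLimits_of_natIso (L.isoLeftKanExtensionYoneda
    (isoWhiskerRight shrinkYonedaIsoYoneda.symm L ≪≫
      Elements.shrinkYonedaCompWhiskeringLeftObjπCompColimIso G))

end CategoryTheory.Functor

/-- Let `A`, `B` be small categories, with `A` having finite limits, and let
`F : A ⥤ Psh(B)` preserve finite limits. Then the left Kan extension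
`F* : Psh(A) ⥤ Psh(B)` of `F` along the Yoneda embedding preserves finite limits. -/
theorem leftKanExtension_along_yoneda_preservesFiniteLimits
    (A B : Type u) [SmallCategory A] [SmallCategory B] [HasFiniteLimits A]
    (F : A ⥤ Bᵒᵖ ⥤ Type u) [PreservesFiniteLimits F] :
    PreservesFiniteLimits (yoneda.leftKanExtension F) := by
  refine ⟨fun J _ _ ↦ preservesLimitsOfShape_of_evaluation _ J fun b ↦ ?_⟩
  have : PreservesFiniteLimits (F ⋙ (evaluation Bᵒᵖ (Type u)).obj b) :=
    comp_preservesFiniteLimits _ _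
  have := (F ⋙ (evaluation _ _).obj b).preservesFiniteLimits_leftKanExtension_yoneda_of_type
  exact preservesLimitsOfShape_of_natIso
    (((evaluation _ _).obj b).leftKanExtensionCompIsoOfPreserves F yoneda).symm
end

section
/- There exist a small category A having equalizers and a functor F : A ⥤ Type preserving equalizers such that the left Kan extension F* : Psh(A) ⥤ Type of F along the Yoneda embedding y_A does not preserve equalizers (i.e., does not preserve limits of walking-parallel-pair shape). -/
open CategoryTheory CategoryTheory.Limits

/-- The left Kan extension along the Yoneda embedding of a `Type`-valued functor sends a presheaf
without elements to an empty type. -/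
theorem isEmpty_yoneda_leftKanExtension_obj {A : Type} [SmallCategory A] (F : A ⥤ Type)
    (P : Aᵒᵖ ⥤ Type) (hP : ∀ X, IsEmpty (P.obj X)) :
    IsEmpty ((yoneda.leftKanExtension F).obj P) := by
  refine ⟨fun x => ?_⟩
  obtain ⟨j, -, -⟩ := Types.jointly_surjective_of_isColimit
    (yoneda.isPointwiseLeftKanExtensionLeftKanExtensionUnit F P) x
  exact (hP _).false (yonedaEquiv j.hom)

/-- The functor with constant value the one-point type preserves limits of every shape. -/
theorem preservesLimitsOfShape_const_punit {A : Type} [SmallCategory A] (J : Type)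
    [SmallCategory J] :
    PreservesLimitsOfShape J ((Functor.const A).obj (PUnit : Type)) where
  preservesLimit :=
    { preserves := fun _ => ⟨
        { lift := fun _ => ↾fun _ => PUnit.unit
          fac := fun _ _ => by ext; rfl
          uniq := fun _ _ _ => by ext; rfl }⟩ }

/-- In a preorder all parallel pairs agree, so equalizers exist. -/
theorem hasEqualizers_of_preorder (A : Type) [Preorder A] : HasEqualizers A := by
  have h : ∀ {X Y : A} {f g : X ⟶ Y}, HasLimit (parallelPair f g) := by
    intro X Y f g
    obtain rfl := Subsingleton.elim f g
    infer_instance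
  exact hasEqualizers_of_hasLimit_parallelPair A

/-- The presheaf of `Bool`-valued functions on the proposition `¬ X ≤ c`: it is `Bool` away from
the principal lower set of `c`, and a point on it. -/
def boolAwayFrom {A : Type} [Preorder A] (c : A) : Aᵒᵖ ⥤ Type where
  obj X := ¬ X.unop ≤ c → Bool
  map f := ↾fun q h => q fun h' => h (f.unop.le.trans h')

/-- The morphism from a representable to `boolAwayFrom c` with constant value `t`. -/
def boolAwayFromConst {A : Type} [Preorder A] (c : A) (t : Bool) (a : A) :
    yoneda.obj a ⟶ boolAwayFrom c where
  app X := ↾fun _ _ => t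

/-- If two elements of a preorder have an upper bound but no lower bound, then the left Kan
extension along the Yoneda embedding of the constant one-point functor does not preserve
equalizers. -/
theorem not_preservesEqualizers_yoneda_leftKanExtension_const {A : Type} [Preorder A]
    {a b c : A} (hb : b ≤ a) (hc : c ≤ a) (hbc : ∀ x, x ≤ b → ¬ x ≤ c) :
    ¬ PreservesLimitsOfShape WalkingParallelPair
      (yoneda.leftKanExtension ((Functor.const A).obj (PUnit : Type))) := by
  intro _
  set F := (Functor.const A).obj (PUnit : Type)
  set L := yoneda.leftKanExtension F
  let α : F ⟶ yoneda ⋙ L := yoneda.leftKanExtensionUnit F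
  have : IsIso α :=
    (yoneda.isPointwiseLeftKanExtensionLeftKanExtensionUnit F).isIso_hom
  have : IsIso (F.map (homOfLE hc)) := inferInstanceAs (IsIso (𝟙 _))
  have : IsIso (L.map (yoneda.map (homOfLE hc))) :=
    (NatIso.isIso_map_iff (asIso α) (homOfLE hc)).1 this
  have ha : L.map (boolAwayFromConst c true a) = L.map (boolAwayFromConst c false a) := by
    rw [← cancel_epi (L.map (yoneda.map (homOfLE hc))), ← L.map_comp, ← L.map_comp]
    congr 1
    ext X u
    funext h
    exact (h u.le).elim
  let f := boolAwayFromConst c true b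
  let g := boolAwayFromConst c false b
  have hfg : L.map f = L.map g := by
    have h (t : Bool) : boolAwayFromConst c t b =
        yoneda.map (homOfLE hb) ≫ boolAwayFromConst c t a := rfl
    simp only [f, g, h, L.map_comp, ha]
  have hE : IsEmpty (L.obj (equalizer f g)) := by
    refine isEmpty_yoneda_leftKanExtension_obj F _ fun X => ⟨fun e => ?_⟩
    have hxb : X.unop ≤ b := ((equalizer.ι f g).app X e).le
    have h := ConcreteCategory.congr_hom (NatTrans.congr_app (equalizer.condition f g) X) e
    exact Bool.noConfusion (congrFun h (hbc _ hxb))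
  obtain ⟨l, -⟩ := Fork.IsLimit.lift' (isLimitOfHasEqualizerOfPreservesLimit L f g) (𝟙 _)
    (by rw [hfg])
  exact hE.false (l (α.app b PUnit.unit))

/-- There exist a small category `A` with equalizers and an equalizer-preserving functor
`F : A ⥤ Type` such that the left Kan extension `F* : Psh(A) ⥤ Type` of `F` along the
Yoneda embedding does not preserve equalizers (limits of walking-parallel-pair shape). -/
theorem exists_leftKanExtension_not_preserving_equalizers :
    ∃ (A : Cat.{0, 0}) (_ : HasEqualizers A) (F : A ⥤ Type)
      (_ : PreservesLimitsOfShape WalkingParallelPair F),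
      ¬ PreservesLimitsOfShape WalkingParallelPair (yoneda.leftKanExtension F) := by
  refine ⟨Cat.of {s : Set Bool // s.Nonempty},
    hasEqualizers_of_preorder {s : Set Bool // s.Nonempty},
    (Functor.const _).obj PUnit, preservesLimitsOfShape_const_punit _,
    not_preservesEqualizers_yoneda_leftKanExtension_const
      (A := {s : Set Bool // s.Nonempty}) (a := ⟨Set.univ, Set.univ_nonempty⟩)
      (b := ⟨{true}, Set.singleton_nonempty _⟩) (c := ⟨{false}, Set.singleton_nonempty _⟩)
      (Set.subset_univ _) (Set.subset_univ _) ?_⟩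
  rintro ⟨s, x, hx⟩ hb hc
  exact Bool.noConfusion ((hb hx).symm.trans (hc hx))
end
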